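/- arXiv:1107.1039 — 3 statements merged into one kernel-verified Lean document; each statement's English description precedes it below -/
import Mathlib

section
/- Let A be a ring equipped with an action of the symmetric group S_n by ring automorphisms, and let a_1,…,a_{n−1} be elements of the center Z(A) such that w(a_i) = a_j whenever w ∈ S_n and w({i,i+1}) = {j,j+1}. Let R be the ring generated by A together with elements ts_1,…,ts_{n−1}, subject to the defining relations: the natural map A → R is a ring homomorphism; ts_i·a = s_i(a)·ts_i for all a ∈ A and 1 ≤ i < n; the ts_i satisfy the braid relations (ts_i ts_j = ts_j ts_i for |i−j| > 1 and ts_{i+1} ts_i ts_{i+1} = ts_i ts_{i+1} ts_i); and ts_i² = a_i for all i. For w ∈ S_n with a reduced expression w = s_{i_1}⋯s_{i_ℓ}, set ts_w = ts_{i_1}⋯ts_{i_ℓ}. Then ts_w is independent of the choice of reduced expression, and the map A ⊗_ℤ ℤ[S_n] → R sending a ⊗ w to a·ts_w is an isomorphism of abelian groups; equivalently, R is a free left A-module with basis {ts_w : w ∈ S_n}. -/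
/-!
STATEMENT 0 (Proposition 3.5 of Kang–Kashiwara–Tsuchioka, "Quiver Hecke superalgebras"):
Let `A` be a ring with an action of `S_n` by ring automorphisms, and `a_1, …, a_{n-1}`
central elements with `w(a_i) = a_j` whenever `w({i,i+1}) = {j,j+1}`.  Let `R` be the ring
generated by `A` and `ts_1, …, ts_{n-1}` with defining relations:
`A → R` is a ring homomorphism, `ts_i a = s_i(a) ts_i`, the braid relations for the `ts_i`,
and `ts_i² = a_i`.  Then for `w ∈ S_n`, the element `ts_w = ts_{i_1} ⋯ ts_{i_ℓ}` attached to
a reduced expression `w = s_{i_1} ⋯ s_{i_ℓ}` is independent of the chosen reduced expression,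
and `A ⊗_ℤ ℤ[S_n] → R`, `a ⊗ w ↦ a ⋅ ts_w`, is an isomorphism of abelian groups.
-/

namespace QuiverHeckeSuper0

def lo {n : ℕ} (i : Fin (n - 1)) : Fin n := ⟨i, by omega⟩
def hi {n : ℕ} (i : Fin (n - 1)) : Fin n := ⟨(i : ℕ) + 1, by omega⟩

/-- The simple transposition `s_i = (i, i+1) ∈ S_n`. -/
def s {n : ℕ} (i : Fin (n - 1)) : Equiv.Perm (Fin n) := Equiv.swap (lo i) (hi i)

variable (n : ℕ) (A : Type) [Ring A] [MulSemiringAction (Equiv.Perm (Fin n)) A]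

/-- The free ring on the elements of `A` together with symbols `ts_1, …, ts_{n-1}`. -/
abbrev FreeGen := FreeAlgebra ℤ (A ⊕ Fin (n - 1))

/-- The generator of the free ring corresponding to `x ∈ A`. -/
def ιA (x : A) : FreeGen n A := FreeAlgebra.ι ℤ (Sum.inl x)

/-- The generator of the free ring corresponding to `ts_i`. -/
def ιT (i : Fin (n - 1)) : FreeGen n A := FreeAlgebra.ι ℤ (Sum.inr i)

/-- The defining relations of the ring `R`: the inclusion `A → R` is a ring homomorphism,
`ts_i ∘ a = s_i(a) ∘ ts_i`, the `ts_i` satisfy the braid relations, and `ts_i² = a_i`. -/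
inductive Rel (a : Fin (n - 1) → A) : FreeGen n A → FreeGen n A → Prop
  | add (x y : A) : Rel a (ιA n A x + ιA n A y) (ιA n A (x + y))
  | mul (x y : A) : Rel a (ιA n A x * ιA n A y) (ιA n A (x * y))
  | one : Rel a (ιA n A 1) 1
  | comm (x : A) (i : Fin (n - 1)) :
      Rel a (ιT n A i * ιA n A x) (ιA n A (s i • x) * ιT n A i)
  | braid_far (i j : Fin (n - 1)) (h : (i : ℕ) + 1 < (j : ℕ) ∨ (j : ℕ) + 1 < (i : ℕ)) :
      Rel a (ιT n A i * ιT n A j) (ιT n A j * ιT n A i)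
  | braid_near (i j : Fin (n - 1)) (h : (j : ℕ) = (i : ℕ) + 1) :
      Rel a (ιT n A j * ιT n A i * ιT n A j) (ιT n A i * ιT n A j * ιT n A i)
  | sq (i : Fin (n - 1)) : Rel a (ιT n A i * ιT n A i) (ιA n A (a i))

/-- The ring `R` generated by `A` and the `ts_i` subject to the defining relations. -/
abbrev R (a : Fin (n - 1) → A) := RingQuot (Rel n A a)

/-- The canonical map `A → R`. -/
def embA (a : Fin (n - 1) → A) (x : A) : R n A a := RingQuot.mkRingHom (Rel n A a) (ιA n A x)

/-- The element `ts_i ∈ R`. -/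
def ts (a : Fin (n - 1) → A) (i : Fin (n - 1)) : R n A a :=
  RingQuot.mkRingHom (Rel n A a) (ιT n A i)

/-- `ts_{i_1} ⋯ ts_{i_ℓ}` for a word `l = (i_1, …, i_ℓ)`. -/
def tsProd (a : Fin (n - 1) → A) (l : List (Fin (n - 1))) : R n A a := (l.map (ts n A a)).prod

/-- `l` is a reduced expression of `w ∈ S_n`: the product of the corresponding simple
transpositions is `w`, and no shorter word has this property. -/
def IsReducedWord (l : List (Fin (n - 1))) (w : Equiv.Perm (Fin n)) : Prop :=
  (l.map s).prod = w ∧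
    ∀ l' : List (Fin (n - 1)), (l'.map s).prod = w → l.length ≤ l'.length

section Combinatorics

variable {n}

lemma lo_lt_hi (i : Fin (n - 1)) : lo i < hi i := by
  simp [lo, hi, Fin.lt_def]

@[simp] lemma s_mul_self (i : Fin (n - 1)) : s i * s i = 1 := Equiv.swap_mul_self _ _

@[simp] lemma s_mul_cancel_left (i : Fin (n - 1)) (w : Equiv.Perm (Fin n)) :
    s i * (s i * w) = w := by
  rw [← mul_assoc, s_mul_self, one_mul]

@[simp] lemma s_inv (i : Fin (n - 1)) : (s i)⁻¹ = s i := Equiv.swap_inv _ _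

@[simp] lemma s_lo (i : Fin (n - 1)) : s i (lo i) = hi i := Equiv.swap_apply_left _ _

@[simp] lemma s_hi (i : Fin (n - 1)) : s i (hi i) = lo i := Equiv.swap_apply_right _ _

lemma val_s (i : Fin (n - 1)) (p : Fin n) :
    (s i p : ℕ) = if (p : ℕ) = i then (i : ℕ) + 1 else if (p : ℕ) = i + 1 then (i : ℕ) else p := by
  simp only [s, Equiv.swap_apply_def, lo, hi, Fin.ext_iff]
  split_ifs <;> rfl

lemma s_far_comm {i j : Fin (n - 1)} (h : (i : ℕ) + 1 < (j : ℕ) ∨ (j : ℕ) + 1 < (i : ℕ)) :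
    s i * s j = s j * s i := by
  ext p
  simp only [Equiv.Perm.mul_apply, val_s]
  grind

lemma s_near_braid {i j : Fin (n - 1)} (h : (j : ℕ) = (i : ℕ) + 1) :
    s j * (s i * s j) = s i * (s j * s i) := by
  ext p
  simp only [Equiv.Perm.mul_apply, val_s]
  grind

/-- Left multiplication by `s_i` increases the length of `w`. -/
def IsAscent (i : Fin (n - 1)) (w : Equiv.Perm (Fin n)) : Prop := w⁻¹ (lo i) < w⁻¹ (hi i)

lemma isAscent_s_mul_iff (i : Fin (n - 1)) (w : Equiv.Perm (Fin n)) :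
    IsAscent i (s i * w) ↔ ¬ IsAscent i w := by
  have : w⁻¹ (lo i) ≠ w⁻¹ (hi i) := fun h => (lo_lt_hi i).ne (w⁻¹.injective h)
  simp only [IsAscent, mul_inv_rev, s_inv, Equiv.Perm.mul_apply, s_lo, s_hi, not_lt]
  exact ⟨le_of_lt, fun h => lt_of_le_of_ne h this.symm⟩

/-- The inversions of `w⁻¹`. -/
def invSet (w : Equiv.Perm (Fin n)) : Finset (Fin n × Fin n) :=
  {p | p.1 < p.2 ∧ w⁻¹ p.2 < w⁻¹ p.1}

lemma s_lt_s_iff {i : Fin (n - 1)} {p q : Fin n} (h : ¬ (p = lo i ∧ q = hi i))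
    (h' : ¬ (p = hi i ∧ q = lo i)) : s i p < s i q ↔ p < q := by
  simp only [Fin.lt_def, val_s, Fin.ext_iff, lo, hi] at *
  grind

lemma invSet_s_mul {i : Fin (n - 1)} {w : Equiv.Perm (Fin n)} (h : IsAscent i w) :
    invSet (s i * w) =
      insert (lo i, hi i) ((invSet w).map (Equiv.prodCongr (s i) (s i)).toEmbedding) := by
  ext ⟨p, q⟩
  rw [Finset.mem_insert, Finset.mem_map_equiv]
  simp only [invSet, Finset.mem_filter, Finset.mem_univ, true_and, Equiv.prodCongr_symm,
    Equiv.prodCongr_apply, Prod.map, mul_inv_rev, s_inv, Equiv.Perm.mul_apply, Prod.mk.injEq]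
  have hs : (s i).symm = s i := s_inv i
  rw [hs]
  unfold IsAscent at h
  by_cases h1 : p = lo i ∧ q = hi i
  · obtain ⟨rfl, rfl⟩ := h1
    simpa [lo_lt_hi] using h
  · by_cases h2 : p = hi i ∧ q = lo i
    · obtain ⟨rfl, rfl⟩ := h2
      simp only [s_lo, s_hi, (lo_lt_hi i).not_gt, (lo_lt_hi i).ne', h.not_gt, false_and, and_false,
        or_self]
    · rw [s_lt_s_iff h1 h2]
      simp [h1]

lemma card_invSet_s_mul {i : Fin (n - 1)} {w : Equiv.Perm (Fin n)} (h : IsAscent i w) :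
    (invSet (s i * w)).card = (invSet w).card + 1 := by
  rw [invSet_s_mul h, Finset.card_insert_of_notMem, Finset.card_map]
  rw [Finset.mem_map_equiv]
  have hs : (s i).symm = s i := s_inv i
  simp [invSet, hs, (lo_lt_hi i).le]

lemma card_invSet_of_not_isAscent {i : Fin (n - 1)} {w : Equiv.Perm (Fin n)}
    (h : ¬ IsAscent i w) : (invSet w).card = (invSet (s i * w)).card + 1 := by
  have := card_invSet_s_mul ((isAscent_s_mul_iff i w).2 h)
  rwa [s_mul_cancel_left] at this

lemma card_invSet_prod_le (l : List (Fin (n - 1))) :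
    (invSet (l.map s).prod).card ≤ l.length := by
  induction l with
  | nil =>
    simp only [List.map_nil, List.prod_nil, List.length_nil, Nat.le_zero, Finset.card_eq_zero]
    ext p
    simp only [invSet, inv_one, Equiv.Perm.one_apply, Finset.mem_filter, Finset.mem_univ,
      true_and, Finset.notMem_empty, iff_false, not_and, not_lt]
    exact le_of_lt
  | cons i l ih =>
    simp only [List.map_cons, List.prod_cons, List.length_cons]
    by_cases h : IsAscent i (l.map s).prod
    · rw [card_invSet_s_mul h]; omega
    · have := card_invSet_of_not_isAscent h; omega

lemma eq_one_of_forall_isAscent {w : Equiv.Perm (Fin n)} (h : ∀ i, IsAscent i w) : w = 1 := by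
  have hmono : StrictMono (w⁻¹ : Equiv.Perm (Fin n)) := by
    rcases n with _ | n
    · exact fun x => x.elim0
    · exact Fin.strictMono_iff_lt_succ.2 fun i => h i
  have : (w⁻¹ : Equiv.Perm (Fin n)) = 1 := by
    ext p
    have := congrFun (hmono.range_inj (g := id) strictMono_id |>.1 (by simp)) p
    simp [this]
  simpa using this

lemma exists_word (w : Equiv.Perm (Fin n)) :
    ∃ l : List (Fin (n - 1)), (l.map s).prod = w ∧ l.length = (invSet w).card := by
  induction hN : (invSet w).card generalizing w with
  | zero =>
    refine ⟨[], ?_, rfl⟩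
    refine (eq_one_of_forall_isAscent fun i => ?_).symm
    by_contra hi
    have := card_invSet_of_not_isAscent hi
    omega
  | succ N ih =>
    have : ∃ i, ¬ IsAscent i w := by
      by_contra! hc
      have h1 := card_invSet_prod_le (n := n) []
      rw [eq_one_of_forall_isAscent hc] at hN
      simp only [List.map_nil, List.prod_nil, List.length_nil] at h1
      omega
    obtain ⟨i, hi⟩ := this
    have hcard := card_invSet_of_not_isAscent hi
    obtain ⟨l, hl, hlen⟩ := ih (s i * w) (by omega)
    exact ⟨i :: l, by simp [hl], by simp [hlen]⟩

lemma isReducedWord_iff {l : List (Fin (n - 1))} {w : Equiv.Perm (Fin n)} :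
    IsReducedWord n l w ↔ (l.map s).prod = w ∧ l.length = (invSet w).card := by
  constructor
  · rintro ⟨rfl, h⟩
    obtain ⟨l', hl', hlen⟩ := exists_word (l.map s).prod
    exact ⟨rfl, le_antisymm (hlen ▸ h l' hl') (card_invSet_prod_le l)⟩
  · rintro ⟨rfl, h⟩
    exact ⟨rfl, fun l' hl' => h ▸ hl' ▸ card_invSet_prod_le l'⟩

lemma exists_isReducedWord (w : Equiv.Perm (Fin n)) : ∃ l, IsReducedWord n l w := by
  simpa only [isReducedWord_iff] using exists_word w

lemma IsReducedWord.cons {i : Fin (n - 1)} {l : List (Fin (n - 1))} {w : Equiv.Perm (Fin n)}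
    (h : IsReducedWord n l (s i * w)) (hi : ¬ IsAscent i w) : IsReducedWord n (i :: l) w := by
  rw [isReducedWord_iff] at h ⊢
  exact ⟨by simp [h.1], by rw [card_invSet_of_not_isAscent hi, ← h.2]; rfl⟩

lemma isReducedWord_cons_iff {i : Fin (n - 1)} {l : List (Fin (n - 1))}
    {w : Equiv.Perm (Fin n)} :
    IsReducedWord n (i :: l) w ↔ IsReducedWord n l (s i * w) ∧ ¬ IsAscent i w := by
  refine ⟨fun h => ?_, fun h => h.1.cons h.2⟩
  rw [isReducedWord_iff, List.map_cons, List.prod_cons, List.length_cons] at h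
  have hl : (l.map s).prod = s i * w := by rw [← h.1, s_mul_cancel_left]
  have hle := card_invSet_prod_le l
  rw [hl] at hle
  have hasc : ¬ IsAscent i w := fun hasc => by
    have := card_invSet_s_mul hasc
    omega
  have := card_invSet_of_not_isAscent hasc
  exact ⟨isReducedWord_iff.2 ⟨hl, by omega⟩, hasc⟩

lemma s_far_lo {i j : Fin (n - 1)} (h : (i : ℕ) + 1 < (j : ℕ) ∨ (j : ℕ) + 1 < (i : ℕ)) :
    s i (lo j) = lo j := by
  simp only [Fin.ext_iff, val_s, lo]
  grind

lemma s_far_hi {i j : Fin (n - 1)} (h : (i : ℕ) + 1 < (j : ℕ) ∨ (j : ℕ) + 1 < (i : ℕ)) :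
    s i (hi j) = hi j := by
  simp only [Fin.ext_iff, val_s, hi]
  grind

lemma exists_isReducedWord_far {i j : Fin (n - 1)} {w : Equiv.Perm (Fin n)}
    (h : (i : ℕ) + 1 < (j : ℕ) ∨ (j : ℕ) + 1 < (i : ℕ))
    (hi : ¬ IsAscent i w) (hj : ¬ IsAscent j w) :
    ∃ l, IsReducedWord n (i :: j :: l) w ∧ IsReducedWord n (j :: i :: l) w := by
  obtain ⟨l, hl⟩ := exists_isReducedWord (s i * (s j * w))
  have hcomm : s j * (s i * w) = s i * (s j * w) := by
    rw [← mul_assoc, ← s_far_comm h, mul_assoc]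
  have hij : ¬ IsAscent j (s i * w) := by simpa [IsAscent, s_far_lo h, s_far_hi h] using hj
  have hji : ¬ IsAscent i (s j * w) := by
    simpa [IsAscent, s_far_lo h.symm, s_far_hi h.symm] using hi
  exact ⟨l, ((hcomm ▸ hl).cons hij).cons hi, (hl.cons hji).cons hj⟩

lemma lo_eq_hi_of_near {i j : Fin (n - 1)} (h : (j : ℕ) = (i : ℕ) + 1) : lo j = hi i := by
  simp [lo, hi, h]

lemma s_near_lo {i j : Fin (n - 1)} (h : (j : ℕ) = (i : ℕ) + 1) : s j (lo i) = lo i := by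
  simp only [Fin.ext_iff, val_s, lo]
  grind

lemma s_near_hi {i j : Fin (n - 1)} (h : (j : ℕ) = (i : ℕ) + 1) : s i (hi j) = hi j := by
  simp only [Fin.ext_iff, val_s, hi]
  grind

lemma s_near_mid {i j : Fin (n - 1)} (h : (j : ℕ) = (i : ℕ) + 1) : s j (hi i) = hi j := by
  rw [← lo_eq_hi_of_near h, s_lo]

lemma exists_isReducedWord_near {i j : Fin (n - 1)} {w : Equiv.Perm (Fin n)}
    (h : (j : ℕ) = (i : ℕ) + 1) (hi : ¬ IsAscent i w) (hj : ¬ IsAscent j w) :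
    ∃ l, IsReducedWord n (i :: j :: i :: l) w ∧ IsReducedWord n (j :: i :: j :: l) w := by
  obtain ⟨l, hl⟩ := exists_isReducedWord (s i * (s j * (s i * w)))
  have hbraid : s j * (s i * (s j * w)) = s i * (s j * (s i * w)) := by
    simpa only [mul_assoc] using congrArg (· * w) (s_near_braid h)
  have hl' := hbraid ▸ hl
  have hji := lo_eq_hi_of_near h
  have hi' := hi
  have hj' := hj
  simp only [IsAscent, hji, not_lt] at hi' hj'
  refine ⟨l, ((hl.cons ?_).cons ?_).cons hi, ((hl'.cons ?_).cons ?_).cons hj⟩ <;>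
    simp only [IsAscent, mul_inv_rev, s_inv, Equiv.Perm.mul_apply, hji, s_lo, s_hi, s_near_lo h,
      s_near_hi h, s_near_mid h, not_lt] <;>
    first | exact hi' | exact hj' | exact hj'.trans hi'

/-- Matsumoto's theorem for the symmetric group. -/
theorem prod_eq_of_isReducedWord {M : Type*} [Monoid M] {f : Fin (n - 1) → M}
    (hfar : ∀ i j : Fin (n - 1), ((i : ℕ) + 1 < (j : ℕ) ∨ (j : ℕ) + 1 < (i : ℕ)) →
      f i * f j = f j * f i)
    (hnear : ∀ i j : Fin (n - 1), (j : ℕ) = (i : ℕ) + 1 → f j * f i * f j = f i * f j * f i)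
    {w : Equiv.Perm (Fin n)} {l l' : List (Fin (n - 1))}
    (hl : IsReducedWord n l w) (hl' : IsReducedWord n l' w) :
    (l.map f).prod = (l'.map f).prod := by
  have hlen {l l' : List (Fin (n - 1))} {w : Equiv.Perm (Fin n)} (hl : IsReducedWord n l w)
      (hl' : IsReducedWord n l' w) : l.length = l'.length :=
    (isReducedWord_iff.1 hl).2.trans (isReducedWord_iff.1 hl').2.symm
  induction hN : l.length generalizing w l l' with
  | zero =>
    have hN' := hlen hl hl'
    rw [hN, eq_comm, List.length_eq_zero_iff] at hN'
    rw [List.length_eq_zero_iff] at hN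
    rw [hN, hN']
  | succ N ih =>
    have hcons {i : Fin (n - 1)} {k k' : List (Fin (n - 1))} (hk : IsReducedWord n (i :: k) w)
        (hk' : IsReducedWord n (i :: k') w) :
        ((i :: k).map f).prod = ((i :: k').map f).prod := by
      have hlk := hlen hk hl
      rw [List.length_cons, hN] at hlk
      rw [List.map_cons, List.map_cons, List.prod_cons, List.prod_cons,
        ih (isReducedWord_cons_iff.1 hk).1 (isReducedWord_cons_iff.1 hk').1 (by omega)]
    obtain _ | ⟨i, l⟩ := l
    · simp at hN
    obtain _ | ⟨j, l'⟩ := l'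
    · simpa using hlen hl hl'
    have hi := (isReducedWord_cons_iff.1 hl).2
    have hj := (isReducedWord_cons_iff.1 hl').2
    rcases eq_or_ne i j with rfl | hij
    · exact hcons hl hl'
    by_cases hf : (i : ℕ) + 1 < (j : ℕ) ∨ (j : ℕ) + 1 < (i : ℕ)
    · obtain ⟨k, hk, hk'⟩ := exists_isReducedWord_far hf hi hj
      rw [hcons hl hk, hcons hl' hk']
      simp only [List.map_cons, List.prod_cons, ← mul_assoc, hfar i j hf]
    · have hn : (j : ℕ) = i + 1 ∨ (i : ℕ) = j + 1 := by
        have := Fin.val_ne_of_ne hij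
        omega
      rcases hn with hn | hn
      · obtain ⟨k, hk, hk'⟩ := exists_isReducedWord_near hn hi hj
        rw [hcons hl hk, hcons hl' hk']
        simp only [List.map_cons, List.prod_cons, ← mul_assoc, hnear i j hn]
      · obtain ⟨k, hk', hk⟩ := exists_isReducedWord_near hn hj hi
        rw [hcons hl hk, hcons hl' hk']
        simp only [List.map_cons, List.prod_cons, ← mul_assoc, hnear j i hn]

end Combinatorics

section Representation

variable {n A}

instance (i : Fin (n - 1)) (w : Equiv.Perm (Fin n)) : Decidable (IsAscent i w) :=
  inferInstanceAs (Decidable (w⁻¹ (lo i) < w⁻¹ (hi i)))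

/-- The coefficient occurring in the action of `ts_i` on `⨁_w A`. -/
def coeff (a : Fin (n - 1) → A) (i : Fin (n - 1)) (w : Equiv.Perm (Fin n)) : A :=
  if IsAscent i w then a i else 1

lemma coeff_mem_center {B : Type} [Ring B] {b : Fin (n - 1) → B}
    (hcen : ∀ i, b i ∈ Subring.center B) (i : Fin (n - 1)) (w : Equiv.Perm (Fin n)) :
    coeff b i w ∈ Subring.center B := by
  unfold coeff
  split_ifs
  exacts [hcen i, one_mem _]

/-- The action of `ts_i` on families `(x_w)_w`, the family `x` standing for `∑ x_w ts_w`. -/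
def tsEnd (a : Fin (n - 1) → A) (i : Fin (n - 1)) :
    Module.End ℤ (Equiv.Perm (Fin n) → A) :=
  AddMonoidHom.toIntLinearMap
    { toFun := fun f w => coeff a i w * s i • f (s i * w)
      map_zero' := by ext; simp
      map_add' := fun f g => by ext; simp [mul_add] }

@[simp] lemma tsEnd_apply (a : Fin (n - 1) → A) (i : Fin (n - 1)) (f : Equiv.Perm (Fin n) → A)
    (w : Equiv.Perm (Fin n)) : tsEnd a i f w = coeff a i w * s i • f (s i * w) := rfl

variable (n) in
/-- The action of `A` by left multiplication on families indexed by `S_n`. -/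
def mulEnd (x : A) : Module.End ℤ (Equiv.Perm (Fin n) → A) :=
  AddMonoidHom.toIntLinearMap
    { toFun := fun f w => x * f w
      map_zero' := by ext; simp
      map_add' := fun f g => by ext; simp [mul_add] }

@[simp] lemma mulEnd_apply {B : Type} [Ring B] (x : B) (f : Equiv.Perm (Fin n) → B)
    (w : Equiv.Perm (Fin n)) : mulEnd n x f w = x * f w := rfl

lemma tsEnd_mul_mulEnd {a : Fin (n - 1) → A} (hcen : ∀ i, a i ∈ Subring.center A) (x : A)
    (i : Fin (n - 1)) : tsEnd a i * mulEnd n x = mulEnd n (s i • x) * tsEnd a i := by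
  refine LinearMap.ext fun f => funext fun w => ?_
  have h := Subring.mem_center_iff.1 (coeff_mem_center hcen i w) (s i • x)
  simp only [Module.End.mul_apply, tsEnd_apply, mulEnd_apply, smul_mul', ← mul_assoc, h]

lemma smul_coeff {a : Fin (n - 1) → A}
    (hsym : ∀ (w : Equiv.Perm (Fin n)) (i j : Fin (n - 1)),
      (⇑w '' {lo i, hi i} : Set (Fin n)) = {lo j, hi j} → w • a i = a j)
    {u w w' : Equiv.Perm (Fin n)} {i j : Fin (n - 1)} (hlo : u (lo i) = lo j)
    (hhi : u (hi i) = hi j) (hlo' : w⁻¹ (lo i) = w'⁻¹ (lo j)) (hhi' : w⁻¹ (hi i) = w'⁻¹ (hi j)) :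
    u • coeff a i w = coeff a j w' := by
  have h := hsym u i j (by rw [Set.image_pair, hlo, hhi])
  have hiff : IsAscent i w ↔ IsAscent j w' := by simp only [IsAscent, hlo', hhi']
  by_cases hw : IsAscent j w' <;> simp [coeff, hiff, hw, h]

lemma tsEnd_mul_self {a : Fin (n - 1) → A}
    (hsym : ∀ (w : Equiv.Perm (Fin n)) (i j : Fin (n - 1)),
      (⇑w '' {lo i, hi i} : Set (Fin n)) = {lo j, hi j} → w • a i = a j) (i : Fin (n - 1)) :
    tsEnd a i * tsEnd a i = mulEnd n (a i) := by
  refine LinearMap.ext fun f => funext fun w => ?_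
  have h := hsym (s i) i i (by rw [Set.image_pair, s_lo, s_hi, Set.pair_comm])
  simp only [Module.End.mul_apply, tsEnd_apply, mulEnd_apply, smul_mul', smul_smul,
    s_mul_self, one_smul, ← mul_assoc]
  congr 1
  by_cases hw : IsAscent i w <;> simp [coeff, isAscent_s_mul_iff, hw, h]

lemma tsEnd_far {a : Fin (n - 1) → A} (hcen : ∀ i, a i ∈ Subring.center A)
    (hsym : ∀ (w : Equiv.Perm (Fin n)) (i j : Fin (n - 1)),
      (⇑w '' {lo i, hi i} : Set (Fin n)) = {lo j, hi j} → w • a i = a j) {i j : Fin (n - 1)}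
    (h : (i : ℕ) + 1 < (j : ℕ) ∨ (j : ℕ) + 1 < (i : ℕ)) :
    tsEnd a i * tsEnd a j = tsEnd a j * tsEnd a i := by
  refine LinearMap.ext fun f => funext fun w => ?_
  have hcomm : s j * (s i * w) = s i * (s j * w) := by
    rw [← mul_assoc, ← s_far_comm h, mul_assoc]
  have hj : s i • coeff a j (s i * w) = coeff a j w :=
    smul_coeff hsym (s_far_lo h) (s_far_hi h) (by simp [s_far_lo h]) (by simp [s_far_hi h])
  have hi : s j • coeff a i (s j * w) = coeff a i w :=
    smul_coeff hsym (s_far_lo h.symm) (s_far_hi h.symm) (by simp [s_far_lo h.symm])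
      (by simp [s_far_hi h.symm])
  simp only [Module.End.mul_apply, tsEnd_apply, smul_mul', smul_smul, s_far_comm h, hi, hj, hcomm,
    ← mul_assoc]
  rw [Subring.mem_center_iff.1 (coeff_mem_center hcen i w)]

lemma tsEnd_near {a : Fin (n - 1) → A} (hcen : ∀ i, a i ∈ Subring.center A)
    (hsym : ∀ (w : Equiv.Perm (Fin n)) (i j : Fin (n - 1)),
      (⇑w '' {lo i, hi i} : Set (Fin n)) = {lo j, hi j} → w • a i = a j) {i j : Fin (n - 1)}
    (h : (j : ℕ) = (i : ℕ) + 1) :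
    tsEnd a j * tsEnd a i * tsEnd a j = tsEnd a i * tsEnd a j * tsEnd a i := by
  refine LinearMap.ext fun f => funext fun w => ?_
  have hji := lo_eq_hi_of_near h
  have hbraid : s j * (s i * (s j * w)) = s i * (s j * (s i * w)) := by
    simpa only [mul_assoc] using congrArg (· * w) (s_near_braid h)
  have hj : s i • s j • coeff a i (s j * (s i * w)) = coeff a j w := by
    rw [smul_smul]
    apply smul_coeff hsym <;> simp [s_near_lo h, s_near_hi h, s_near_mid h, hji]
  have hi : s j • s i • coeff a j (s i * (s j * w)) = coeff a i w := by
    rw [smul_smul]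
    apply smul_coeff hsym <;> simp [s_near_lo h, s_near_hi h, hji]
  have hmid : s j • coeff a i (s j * w) = s i • coeff a j (s i * w) := by
    rw [← inv_smul_eq_iff, s_inv, smul_smul]
    apply smul_coeff hsym <;> simp [s_near_lo h, s_near_hi h, s_near_mid h, hji]
  simp only [Module.End.mul_apply, tsEnd_apply, smul_mul', hi, hj, hmid, hbraid]
  rw [smul_smul, smul_smul, smul_smul, smul_smul, mul_assoc, mul_assoc, s_near_braid h]
  simp only [← mul_assoc]
  have ci := Subring.mem_center_iff.1 (coeff_mem_center hcen i w)
  have cj := Subring.mem_center_iff.1 (coeff_mem_center hcen j w)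
  rw [ci, mul_assoc (coeff a i w), ← cj, ← mul_assoc, ← mul_assoc]

end Representation

section Ring

variable {n A} {a : Fin (n - 1) → A}

lemma embA_add (x y : A) : embA n A a (x + y) = embA n A a x + embA n A a y := by
  rw [embA, ← RingQuot.mkRingHom_rel (Rel.add x y), map_add]
  rfl

lemma embA_mul (x y : A) : embA n A a (x * y) = embA n A a x * embA n A a y := by
  rw [embA, ← RingQuot.mkRingHom_rel (Rel.mul x y), map_mul]
  rfl

lemma embA_one : embA n A a 1 = 1 := by
  rw [embA, RingQuot.mkRingHom_rel Rel.one, map_one]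

lemma ts_mul_embA (i : Fin (n - 1)) (x : A) :
    ts n A a i * embA n A a x = embA n A a (s i • x) * ts n A a i := by
  simpa only [ts, embA, map_mul] using RingQuot.mkRingHom_rel (Rel.comm (a := a) x i)

lemma ts_far (i j : Fin (n - 1)) (h : (i : ℕ) + 1 < (j : ℕ) ∨ (j : ℕ) + 1 < (i : ℕ)) :
    ts n A a i * ts n A a j = ts n A a j * ts n A a i := by
  simpa only [ts, map_mul] using RingQuot.mkRingHom_rel (Rel.braid_far (a := a) i j h)

lemma ts_near (i j : Fin (n - 1)) (h : (j : ℕ) = (i : ℕ) + 1) :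
    ts n A a j * ts n A a i * ts n A a j = ts n A a i * ts n A a j * ts n A a i := by
  simpa only [ts, map_mul] using RingQuot.mkRingHom_rel (Rel.braid_near (a := a) i j h)

lemma ts_mul_self (i : Fin (n - 1)) : ts n A a i * ts n A a i = embA n A a (a i) := by
  simpa only [ts, embA, map_mul] using RingQuot.mkRingHom_rel (Rel.sq (a := a) i)

lemma tsProd_eq_of_isReducedWord {w : Equiv.Perm (Fin n)} {l l' : List (Fin (n - 1))}
    (hl : IsReducedWord n l w) (hl' : IsReducedWord n l' w) :
    tsProd n A a l = tsProd n A a l' :=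
  prod_eq_of_isReducedWord ts_far ts_near hl hl'

lemma tsProd_cons (i : Fin (n - 1)) (l : List (Fin (n - 1))) :
    tsProd n A a (i :: l) = ts n A a i * tsProd n A a l := by
  simp [tsProd]

variable (n A a) in
/-- The canonical map `A → R` as an additive homomorphism. -/
def embAHom : A →+ R n A a := AddMonoidHom.mk' (embA n A a) embA_add

/-- The generators of `R` act on the families `(x_w)_w` of elements of `A`. -/
theorem exists_representation (hcen : ∀ i, a i ∈ Subring.center A)
    (hsym : ∀ (w : Equiv.Perm (Fin n)) (i j : Fin (n - 1)),
      (⇑w '' {lo i, hi i} : Set (Fin n)) = {lo j, hi j} → w • a i = a j) :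
    ∃ ρ : R n A a →+* Module.End ℤ (Equiv.Perm (Fin n) → A),
      (∀ x, ρ (embA n A a x) = mulEnd n x) ∧ ∀ i, ρ (ts n A a i) = tsEnd a i := by
  let F : FreeGen n A →ₐ[ℤ] Module.End ℤ (Equiv.Perm (Fin n) → A) :=
    FreeAlgebra.lift ℤ (Sum.elim (mulEnd n) (tsEnd a))
  have hA (x : A) : F (ιA n A x) = mulEnd n x := by simp [F, ιA]
  have hT (i : Fin (n - 1)) : F (ιT n A i) = tsEnd a i := by simp [F, ιT]
  have hrel : ∀ ⦃x y⦄, Rel n A a x y → F.toRingHom x = F.toRingHom y := by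
    intro x y hxy
    change F x = F y
    cases hxy with
    | add x y => rw [map_add, hA, hA, hA]; ext; simp [add_mul]
    | mul x y =>
      rw [map_mul, hA, hA, hA]
      exact LinearMap.ext fun f => funext fun w => (mul_assoc x y (f w)).symm
    | one =>
      rw [map_one, hA]
      exact LinearMap.ext fun f => funext fun w => one_mul (f w)
    | comm x i => simpa only [map_mul, hA, hT] using tsEnd_mul_mulEnd hcen x i
    | braid_far i j h => simpa only [map_mul, hT] using tsEnd_far hcen hsym h
    | braid_near i j h => simpa only [map_mul, hT] using tsEnd_near hcen hsym h
    | sq i => simpa only [map_mul, hA, hT] using tsEnd_mul_self hsym i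
  refine ⟨RingQuot.lift ⟨F.toRingHom, hrel⟩, fun x => ?_, fun i => ?_⟩
  · rw [embA, RingQuot.lift_mkRingHom_apply]
    exact hA x
  · rw [ts, RingQuot.lift_mkRingHom_apply]
    exact hT i

lemma tsEnd_single {i : Fin (n - 1)} {w : Equiv.Perm (Fin n)} (h : ¬ IsAscent i w) :
    tsEnd a i (Pi.single (s i * w) 1) = Pi.single w 1 := by
  funext u
  rw [tsEnd_apply]
  rcases eq_or_ne u w with rfl | hu
  · simp [coeff, h]
  · rw [Pi.single_eq_of_ne hu, Pi.single_eq_of_ne (fun h => hu (mul_left_cancel h)), smul_zero,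
      mul_zero]

lemma representation_tsProd_apply {ρ : R n A a →+* Module.End ℤ (Equiv.Perm (Fin n) → A)}
    (hρ : ∀ i, ρ (ts n A a i) = tsEnd a i) {l : List (Fin (n - 1))} {w : Equiv.Perm (Fin n)}
    (hl : IsReducedWord n l w) : ρ (tsProd n A a l) (Pi.single 1 1) = Pi.single w 1 := by
  induction l generalizing w with
  | nil =>
    obtain rfl : 1 = w := hl.1
    simp [tsProd]
  | cons i l ih =>
    rw [isReducedWord_cons_iff] at hl
    rw [tsProd_cons, map_mul, hρ, Module.End.mul_apply, ih hl.1, tsEnd_single hl.2]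

variable (a) in
/-- The map `A ⊗ ℤ[S_n] → R`, `x ⊗ w ↦ x ts_w`. -/
noncomputable def tensorHom (red : Equiv.Perm (Fin n) → List (Fin (n - 1))) :
    TensorProduct ℤ A (MonoidAlgebra ℤ (Equiv.Perm (Fin n))) →+ R n A a :=
  (LinearMap.mul' ℤ (R n A a)).toAddMonoidHom.comp
    (TensorProduct.map (embAHom n A a).toIntLinearMap
      (MonoidAlgebra.liftNC (Int.castAddHom (R n A a))
        fun w => tsProd n A a (red w)).toIntLinearMap).toAddMonoidHom

lemma tensorHom_tmul_single (red : Equiv.Perm (Fin n) → List (Fin (n - 1))) (x : A)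
    (w : Equiv.Perm (Fin n)) :
    tensorHom a red (x ⊗ₜ[ℤ] MonoidAlgebra.single w (1 : ℤ)) =
      embA n A a x * tsProd n A a (red w) := by
  simp [tensorHom, embAHom]

lemma tensor_induction {B G : Type*} [Ring B]
    {motive : TensorProduct ℤ B (MonoidAlgebra ℤ G) → Prop}
    (t : TensorProduct ℤ B (MonoidAlgebra ℤ G)) (zero : motive 0)
    (add : ∀ t t', motive t → motive t' → motive (t + t'))
    (single : ∀ x w, motive (x ⊗ₜ[ℤ] MonoidAlgebra.single w (1 : ℤ))) : motive t := by
  induction t using TensorProduct.induction_on with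
  | zero => exact zero
  | add t t' ht ht' => exact add t t' ht ht'
  | tmul x y =>
    induction y using MonoidAlgebra.induction_linear with
    | zero => simpa using zero
    | add y z hy hz => simpa [TensorProduct.tmul_add] using add _ _ hy hz
    | single w m =>
      have : MonoidAlgebra.single w m = m • MonoidAlgebra.single w (1 : ℤ) := by simp
      rw [this, ← TensorProduct.smul_tmul]
      exact single _ _

theorem tensorHom_injective (hcen : ∀ i, a i ∈ Subring.center A)
    (hsym : ∀ (w : Equiv.Perm (Fin n)) (i j : Fin (n - 1)),
      (⇑w '' {lo i, hi i} : Set (Fin n)) = {lo j, hi j} → w • a i = a j)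
    {red : Equiv.Perm (Fin n) → List (Fin (n - 1))} (hred : ∀ w, IsReducedWord n (red w) w) :
    Function.Injective (tensorHom a red) := by
  obtain ⟨ρ, hA, hT⟩ := exists_representation hcen hsym
  let ψ (r : R n A a) : TensorProduct ℤ A (MonoidAlgebra ℤ (Equiv.Perm (Fin n))) :=
    ∑ w, ρ r (Pi.single 1 1) w ⊗ₜ[ℤ] MonoidAlgebra.single w (1 : ℤ)
  refine Function.LeftInverse.injective (g := ψ) fun t => ?_
  induction t using tensor_induction with
  | zero => simp [ψ]
  | add t t' ht ht' =>
    conv_rhs => rw [← ht, ← ht']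
    simp [ψ, TensorProduct.add_tmul, Finset.sum_add_distrib]
  | single x w =>
    simp only [ψ, tensorHom_tmul_single, map_mul, hA, Module.End.mul_apply,
      representation_tsProd_apply hT (hred w), mulEnd_apply]
    rw [Finset.sum_eq_single w]
    · simp
    · intro u _ hu
      simp [Pi.single_eq_of_ne hu]
    · simp

lemma ts_mul_tsProd_mem {red : Equiv.Perm (Fin n) → List (Fin (n - 1))}
    (hred : ∀ w, IsReducedWord n (red w) w) (i : Fin (n - 1)) (w : Equiv.Perm (Fin n)) :
    ∃ x, ts n A a i * tsProd n A a (red w) = embA n A a x * tsProd n A a (red (s i * w)) := by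
  by_cases h : IsAscent i w
  · refine ⟨1, ?_⟩
    rw [embA_one, one_mul, ← tsProd_cons]
    refine tsProd_eq_of_isReducedWord (IsReducedWord.cons ?_ ?_) (hred (s i * w))
    · rw [s_mul_cancel_left]
      exact hred w
    · rw [isAscent_s_mul_iff, not_not]
      exact h
  · refine ⟨a i, ?_⟩
    rw [tsProd_eq_of_isReducedWord (hred w) ((hred (s i * w)).cons h), tsProd_cons, ← mul_assoc,
      ts_mul_self]

theorem tensorHom_surjective {red : Equiv.Perm (Fin n) → List (Fin (n - 1))}
    (hred : ∀ w, IsReducedWord n (red w) w) : Function.Surjective (tensorHom a red) := by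
  have hmul (r : FreeGen n A) :
      ∀ t, ∃ t', tensorHom a red t' = RingQuot.mkRingHom (Rel n A a) r * tensorHom a red t := by
    induction r using FreeAlgebra.induction with
    | grade0 m => exact fun t => ⟨m • t, by rw [map_zsmul, zsmul_eq_mul]; simp⟩
    | mul p q hp hq =>
      intro t
      obtain ⟨t', ht'⟩ := hq t
      obtain ⟨t'', ht''⟩ := hp t'
      exact ⟨t'', by rw [ht'', ht', map_mul, mul_assoc]⟩
    | add p q hp hq =>
      intro t
      obtain ⟨t', ht'⟩ := hp t
      obtain ⟨t'', ht''⟩ := hq t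
      exact ⟨t' + t'', by rw [map_add, ht', ht'', map_add, add_mul]⟩
    | grade1 g =>
      intro t
      induction t using tensor_induction with
      | zero => exact ⟨0, by simp⟩
      | add t t' ht ht' =>
        obtain ⟨u, hu⟩ := ht
        obtain ⟨u', hu'⟩ := ht'
        exact ⟨u + u', by rw [map_add, hu, hu', map_add, mul_add]⟩
      | single x w =>
        rw [tensorHom_tmul_single]
        obtain y | i := g
        · refine ⟨(y * x) ⊗ₜ[ℤ] MonoidAlgebra.single w (1 : ℤ), ?_⟩
          rw [tensorHom_tmul_single, embA_mul, mul_assoc]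
          rfl
        · obtain ⟨y, hy⟩ := ts_mul_tsProd_mem (a := a) hred i w
          refine ⟨(s i • x * y) ⊗ₜ[ℤ] MonoidAlgebra.single (s i * w) (1 : ℤ), ?_⟩
          rw [tensorHom_tmul_single, embA_mul, mul_assoc, ← hy, ← mul_assoc, ← ts_mul_embA,
            mul_assoc]
          rfl
  intro r
  obtain ⟨p, rfl⟩ := RingQuot.mkRingHom_surjective (Rel n A a) r
  have hone : tensorHom a red (1 ⊗ₜ[ℤ] MonoidAlgebra.single 1 (1 : ℤ)) = 1 := by
    have hnil : IsReducedWord n [] 1 := ⟨rfl, fun l' _ => Nat.zero_le _⟩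
    rw [tensorHom_tmul_single, embA_one, tsProd_eq_of_isReducedWord (hred 1) hnil]
    simp [tsProd]
  obtain ⟨t, ht⟩ := hmul p (1 ⊗ₜ[ℤ] MonoidAlgebra.single 1 (1 : ℤ))
  exact ⟨t, by rw [ht, hone, mul_one]⟩

end Ring

theorem twisted_group_ring_basis
    (a : Fin (n - 1) → A) (hcen : ∀ i, a i ∈ Subring.center A)
    (hsym : ∀ (w : Equiv.Perm (Fin n)) (i j : Fin (n - 1)),
      (⇑w '' {lo i, hi i} : Set (Fin n)) = {lo j, hi j} → w • a i = a j) :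
    -- `ts_w` does not depend on the choice of a reduced expression of `w` …
    (∀ (w : Equiv.Perm (Fin n)) (l l' : List (Fin (n - 1))),
        IsReducedWord n l w → IsReducedWord n l' w → tsProd n A a l = tsProd n A a l')
    ∧
    -- … and `A ⊗_ℤ ℤ[S_n] ≃ R`, `x ⊗ w ↦ x ⋅ ts_w`, as additive groups.
    (∀ red : Equiv.Perm (Fin n) → List (Fin (n - 1)),
        (∀ w, IsReducedWord n (red w) w) →
        ∃ φ : TensorProduct ℤ A (MonoidAlgebra ℤ (Equiv.Perm (Fin n))) ≃+ R n A a,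
          ∀ (x : A) (w : Equiv.Perm (Fin n)),
            φ (x ⊗ₜ[ℤ] MonoidAlgebra.single w (1 : ℤ)) =
              embA n A a x * tsProd n A a (red w)) := by
  refine ⟨fun w l l' hl hl' => tsProd_eq_of_isReducedWord hl hl', fun red hred => ?_⟩
  exact ⟨AddEquiv.ofBijective (tensorHom a red)
    ⟨tensorHom_injective hcen hsym hred, tensorHom_surjective hred⟩,
    tensorHom_tmul_single red⟩

end QuiverHeckeSuper0
end

section
/- Let A be a ring equipped with an action of the symmetric group S_n by ring automorphisms, and let a_1,…,a_{n−1} be elements of the center Z(A). Then the following two conditions are equivalent: (1) w(a_i) = a_j for all w ∈ S_n and all 1 ≤ i, j < n such that w({i,i+1}) = {j,j+1}; (2) s_j(a_i) = a_i whenever j ∉ {i−1, i+1}, and s_{i+1}(a_i) = s_i(a_{i+1}) for all 1 ≤ i ≤ n−2. -/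
/-!
STATEMENT 1: Let `A` be a ring with an action of the symmetric group `S_n` by ring
automorphisms, and let `a_1, …, a_{n-1}` be elements of the center `Z(A)`.
Then the condition
  (1) `w(a_i) = a_j` whenever `w({i, i+1}) = {j, j+1}`
is equivalent to the condition
  (2) `s_j(a_i) = a_i` if `j ∉ {i-1, i+1}`, and `s_{i+1}(a_i) = s_i(a_{i+1})`.
Here `s_i = (i, i+1)` are the simple transpositions.
-/

namespace QuiverHeckeSuper1

/-- The element `i` of `{1,…,n}` (0-indexed: `i ∈ Fin n`) attached to `i ∈ Fin (n-1)`. -/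
def lo {n : ℕ} (i : Fin (n - 1)) : Fin n := ⟨i, by omega⟩

/-- The element `i+1` of `{1,…,n}` attached to `i ∈ Fin (n-1)`. -/
def hi {n : ℕ} (i : Fin (n - 1)) : Fin n := ⟨(i : ℕ) + 1, by omega⟩

/-- The simple transposition `s_i = (i, i+1) ∈ S_n`. -/
def s {n : ℕ} (i : Fin (n - 1)) : Equiv.Perm (Fin n) := Equiv.swap (lo i) (hi i)

section PairElements

variable {G A : Type*} [Group G] [MulAction G A]

/-- The element attached to the pair `x < y`, namely `σ (y - 1) ⋯ σ (x + 1) • a x`. -/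
def pairElt (σ : ℕ → G) (a : ℕ → A) (x : ℕ) : ℕ → A
  | 0 => a x
  | y + 1 => if y ≤ x then a x else σ y • pairElt σ a x y

variable {σ : ℕ → G} {a : ℕ → A} {N : ℕ}

theorem pairElt_adjacent (x : ℕ) : pairElt σ a x (x + 1) = a x := by
  simp [pairElt]

theorem pairElt_succ {x y : ℕ} (h : x < y) :
    pairElt σ a x (y + 1) = σ y • pairElt σ a x y := by
  simp [pairElt, h]

/-- The relations of the symmetric group on `N + 1` letters and the compatibility of the family `a`
with the simple reflections. -/
structure IsCompatible (σ : ℕ → G) (a : ℕ → A) (N : ℕ) : Prop where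
  sq : ∀ k < N, σ k * σ k = 1
  comm : ∀ k l, k + 1 < l → l < N → σ k * σ l = σ l * σ k
  braid : ∀ k, k + 1 < N → σ k * σ (k + 1) * σ k = σ (k + 1) * σ k * σ (k + 1)
  fix_self : ∀ k < N, σ k • a k = a k
  fix_gt : ∀ k l, k + 1 < l → l < N → σ l • a k = a k
  fix_lt : ∀ k l, k + 1 < l → l < N → σ k • a l = a l
  move : ∀ k, k + 1 < N → σ (k + 1) • a k = σ k • a (k + 1)

namespace IsCompatible

theorem smul_smul_self (H : IsCompatible σ a N) {k : ℕ} (hk : k < N) (u : A) : σ k • σ k • u = u := by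
  rw [smul_smul, H.sq k hk, one_smul]

theorem smul_comm (H : IsCompatible σ a N) {k l : ℕ} (hkl : k + 1 < l) (hl : l < N) (u : A) :
    σ k • σ l • u = σ l • σ k • u := by
  rw [smul_smul, smul_smul, H.comm k l hkl hl]

theorem smul_of_gt (H : IsCompatible σ a N) {x y k : ℕ} (hxy : x < y) (hyk : y < k) (hk : k < N) :
    σ k • pairElt σ a x y = pairElt σ a x y := by
  induction y, hxy using Nat.le_induction with
  | base => rw [pairElt_adjacent, H.fix_gt x k hyk hk]
  | succ y hxy ih =>
    rw [pairElt_succ hxy, ← H.smul_comm hyk hk, ih (by omega)]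

theorem smul_of_between (H : IsCompatible σ a N) {x y k : ℕ} (hxk : x < k) (hky : k + 1 < y) (hy : y ≤ N) :
    σ k • pairElt σ a x y = pairElt σ a x y := by
  induction y, hky using Nat.le_induction with
  | base =>
    rw [pairElt_succ (by omega), pairElt_succ hxk, smul_smul, smul_smul, H.braid k hy,
      mul_smul, mul_smul, H.smul_of_gt hxk (by omega) hy]
  | succ y hky ih =>
    rw [pairElt_succ (by omega), H.smul_comm hky hy, ih (by omega)]

theorem smul_of_lt (H : IsCompatible σ a N) {x y k : ℕ} (hxy : x < y) (hkx : k + 1 < x) (hy : y ≤ N) :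
    σ k • pairElt σ a x y = pairElt σ a x y := by
  induction y, hxy using Nat.le_induction with
  | base => rw [pairElt_adjacent, H.fix_lt k x hkx hy]
  | succ y hxy ih =>
    rw [pairElt_succ hxy, H.smul_comm (by omega) hy, ih (by omega)]

theorem smul_left (H : IsCompatible σ a N) {x y : ℕ} (hxy : x + 1 < y) (hy : y ≤ N) :
    σ x • pairElt σ a x y = pairElt σ a (x + 1) y := by
  induction y, hxy using Nat.le_induction with
  | base =>
    rw [pairElt_succ (by omega), pairElt_adjacent, pairElt_adjacent, H.move x hy,
      H.smul_smul_self (by omega)]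
  | succ y hxy ih =>
    rw [pairElt_succ (by omega), H.smul_comm hxy hy, ih (by omega), pairElt_succ hxy]

theorem smul_pairElt (H : IsCompatible σ a N) {x y k : ℕ} (hxy : x < y) (hy : y ≤ N) (hk : k < N) :
    σ k • pairElt σ a x y =
      pairElt σ a (min (Equiv.swap k (k + 1) x) (Equiv.swap k (k + 1) y))
        (max (Equiv.swap k (k + 1) x) (Equiv.swap k (k + 1) y)) := by
  have key : ∀ p q : ℕ, p < q → (Equiv.swap k (k + 1) x = p ∧ Equiv.swap k (k + 1) y = q ∨
      Equiv.swap k (k + 1) x = q ∧ Equiv.swap k (k + 1) y = p) →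
      σ k • pairElt σ a x y = pairElt σ a p q →
      σ k • pairElt σ a x y =
      pairElt σ a (min (Equiv.swap k (k + 1) x) (Equiv.swap k (k + 1) y))
        (max (Equiv.swap k (k + 1) x) (Equiv.swap k (k + 1) y)) := by
    rintro p q hpq (⟨hx, hy⟩ | ⟨hx, hy⟩) h
    · rw [hx, hy, min_eq_left hpq.le, max_eq_right hpq.le, h]
    · rw [hx, hy, min_eq_right hpq.le, max_eq_left hpq.le, h]
  simp only [Equiv.swap_apply_def] at key ⊢
  rcases lt_trichotomy y k with h | rfl | h
  · exact key x y hxy (by grind) (H.smul_of_gt hxy h hk)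
  · exact key x (y + 1) (by omega) (by grind) (pairElt_succ hxy).symm
  rcases lt_trichotomy x k with h' | rfl | h'
  · rcases (show k + 1 ≤ y from h).eq_or_lt with rfl | h''
    · refine key x k h' (by grind) ?_
      rw [pairElt_succ h', H.smul_smul_self hk]
    · exact key x y hxy (by grind) (H.smul_of_between h' h'' hy)
  · rcases (show x + 1 ≤ y from h).eq_or_lt with rfl | h''
    · refine key x (x + 1) hxy (by grind) ?_
      rw [pairElt_adjacent, H.fix_self x hk]
    · exact key (x + 1) y h'' (by grind) (H.smul_left h'' hy)
  · rcases (show k + 1 ≤ x from h').eq_or_lt with rfl | h''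
    · refine key k y (by omega) (by grind) ?_
      rw [← H.smul_left hxy hy, H.smul_smul_self hk]
    · exact key x y hxy (by grind) (H.smul_of_lt hxy h'' hy)

end IsCompatible

end PairElements

/-- The simple transposition of `Fin n` indexed by a natural number, trivial out of range. -/
def simpleSwap (n k : ℕ) : Equiv.Perm (Fin n) :=
  if h : k < n - 1 then s ⟨k, h⟩ else 1

theorem val_simpleSwap {n k : ℕ} (h : k < n - 1) (x : Fin n) :
    (simpleSwap n k x : ℕ) = Equiv.swap k (k + 1) (x : ℕ) := by
  simp only [simpleSwap, dif_pos h, s, lo, hi, Equiv.swap_apply_def, Fin.ext_iff]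
  split_ifs <;> rfl

theorem simpleSwap_induction {n : ℕ} {p : Equiv.Perm (Fin n) → Prop} (one : p 1)
    (mul : ∀ k < n - 1, ∀ w, p w → p (simpleSwap n k * w)) (w : Equiv.Perm (Fin n)) : p w := by
  cases n with
  | zero => rwa [Subsingleton.elim w 1]
  | succ m =>
    have hw : w ∈ Submonoid.closure
        (Set.range fun i : Fin m ↦ Equiv.swap i.castSucc i.succ) := by
      rw [Equiv.Perm.mclosure_swap_castSucc_succ]; trivial
    induction hw using Submonoid.closure_induction_left with
    | one => exact one
    | mul_left g hg v _ ih =>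
      obtain ⟨i, rfl⟩ := hg
      have := mul i i.isLt v ih
      rwa [simpleSwap, dif_pos (show (i : ℕ) < m + 1 - 1 from i.isLt)] at this

theorem isCompatible_simpleSwap {n : ℕ} {A : Type*} [Zero A] [MulAction (Equiv.Perm (Fin n)) A]
    (a : Fin (n - 1) → A)
    (hfix : ∀ i j : Fin (n - 1), (j : ℤ) ≠ (i : ℤ) - 1 → (j : ℤ) ≠ (i : ℤ) + 1 →
      s j • a i = a i)
    (hmove : ∀ i j : Fin (n - 1), (j : ℕ) = (i : ℕ) + 1 → s j • a i = s i • a j) :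
    IsCompatible (simpleSwap n) (fun k ↦ if h : k < n - 1 then a ⟨k, h⟩ else 0) (n - 1) where
  sq k hk := by
    simp [simpleSwap, hk, s]
  comm k l hkl hl := by
    ext x
    simp only [Equiv.Perm.mul_apply, val_simpleSwap hl, val_simpleSwap (show k < n - 1 by omega),
      Equiv.swap_apply_def]
    grind
  braid k hk := by
    ext x
    simp only [Equiv.Perm.mul_apply, val_simpleSwap hk, val_simpleSwap (show k < n - 1 by omega),
      Equiv.swap_apply_def]
    grind
  fix_self k hk := by
    simp only [simpleSwap, dif_pos hk]
    exact hfix _ _ (by simp only; omega) (by simp only; omega)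
  fix_gt k l hkl hl := by
    simp only [simpleSwap, dif_pos hl, dif_pos (show k < n - 1 by omega)]
    exact hfix _ _ (by simp only; omega) (by simp only; omega)
  fix_lt k l hkl hl := by
    simp only [simpleSwap, dif_pos hl, dif_pos (show k < n - 1 by omega)]
    exact hfix _ _ (by simp only; omega) (by simp only; omega)
  move k hk := by
    simp only [simpleSwap, dif_pos hk, dif_pos (show k < n - 1 by omega)]
    exact hmove _ _ rfl

theorem IsCompatible.perm_smul_pairElt {n : ℕ} {A : Type*} [MulAction (Equiv.Perm (Fin n)) A]
    {a : ℕ → A} (H : IsCompatible (simpleSwap n) a (n - 1)) (w : Equiv.Perm (Fin n))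
    {x y : Fin n} (hxy : x < y) :
    w • pairElt (simpleSwap n) a x y =
      pairElt (simpleSwap n) a (min (w x : ℕ) (w y)) (max (w x : ℕ) (w y)) := by
  have hxy' : (x : ℕ) < y := hxy
  induction w using simpleSwap_induction with
  | one => simp [hxy'.le]
  | mul k hk w ih =>
    have hne : (w x : ℕ) ≠ w y := fun h ↦ hxy.ne (w.injective (Fin.ext h))
    rw [mul_smul, ih, H.smul_pairElt (by omega) (by omega) hk]
    simp only [Equiv.Perm.mul_apply, val_simpleSwap hk]
    rcases hne.lt_or_gt with h | h
    · rw [min_eq_left h.le, max_eq_right h.le]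
    · rw [min_eq_right h.le, max_eq_left h.le,
        min_comm (Equiv.swap k (k + 1) (w y : ℕ)), max_comm (Equiv.swap k (k + 1) (w y : ℕ))]

theorem symmetric_condition_equivalence {n : ℕ} {A : Type*} [Ring A]
    [MulSemiringAction (Equiv.Perm (Fin n)) A]
    (a : Fin (n - 1) → A) (ha : ∀ i, a i ∈ Subring.center A) :
    (∀ (w : Equiv.Perm (Fin n)) (i j : Fin (n - 1)),
        (⇑w '' {lo i, hi i} : Set (Fin n)) = {lo j, hi j} → w • a i = a j)
      ↔
    ((∀ i j : Fin (n - 1), (j : ℤ) ≠ (i : ℤ) - 1 → (j : ℤ) ≠ (i : ℤ) + 1 →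
        s j • a i = a i) ∧
     (∀ i j : Fin (n - 1), (j : ℕ) = (i : ℕ) + 1 → s j • a i = s i • a j)) := by
  constructor
  · intro h
    refine ⟨fun i j h₁ h₂ ↦ h _ _ _ ?_, fun i j hij ↦ ?_⟩
    · by_cases hij : j = i
      · subst hij
        simp [s, Set.image_pair, Set.pair_comm]
      · have hij' : (j : ℕ) ≠ i := fun e ↦ hij (Fin.ext e)
        rw [Set.image_pair, s, Equiv.swap_apply_of_ne_of_ne, Equiv.swap_apply_of_ne_of_ne] <;>
          simp only [lo, hi, ne_eq, Fin.mk.injEq] <;> omega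
    · have hlo : lo j = hi i := Fin.ext hij
      have hlo_ne : lo i ≠ hi j := by simp only [lo, hi, ne_eq, Fin.mk.injEq]; omega
      have hlo_ne' : lo i ≠ hi i := by simp [lo, hi]
      have hhi_ne : hi j ≠ hi i := by simp only [hi, ne_eq, Fin.mk.injEq]; omega
      have key : (s i * s j) • a i = a j := by
        refine h _ _ _ ?_
        rw [Set.image_pair, Equiv.Perm.mul_apply, Equiv.Perm.mul_apply, s, s, hlo,
          Equiv.swap_apply_of_ne_of_ne hlo_ne' hlo_ne, Equiv.swap_apply_left,
          Equiv.swap_apply_left, Equiv.swap_apply_of_ne_of_ne hlo_ne.symm hhi_ne]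
      rw [← key, smul_smul, ← mul_assoc, s.eq_def i, Equiv.swap_mul_self, one_mul]
  · rintro ⟨hfix, hmove⟩ w i j hw
    have H := isCompatible_simpleSwap a hfix hmove
    have key := H.perm_smul_pairElt w (x := lo i) (y := hi i) (by simp [lo, hi])
    rw [Set.image_pair, Set.pair_eq_pair_iff] at hw
    rcases hw with ⟨h₁, h₂⟩ | ⟨h₁, h₂⟩ <;> rw [h₁, h₂] at key <;>
      simpa [lo, hi, pairElt_adjacent] using key

end QuiverHeckeSuper1
end

section
/- In the localized superalgebra MK_n, for any three pairwise distinct indices a, b, c ∈ {1,…,n} one has f_{a,b} f_{b,c} + f_{b,c} f_{c,a} + f_{c,a} f_{a,b} = 0, where f_{a,b} = (y_b − y_a)^{−1} e′_{a,b} + (y_b + y_a)^{−1} c_a c_b e″_{a,b} (in particular f_{a,b} = −f_{b,a}). -/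
/-!
STATEMENT 4 (equation (3.14) of Kang–Kashiwara–Tsuchioka): in the localized
superalgebra `MK_n`, for pairwise distinct `a, b, c`,
`f_{a,b} f_{b,c} + f_{b,c} f_{c,a} + f_{c,a} f_{a,b} = 0`,
where `f_{a,b} = (y_b − y_a)⁻¹ e′_{a,b} + (y_b + y_a)⁻¹ c_a c_b e″_{a,b}`.
-/

namespace QuiverHeckeSuper4

/-- position `a` resp. `a+1` in `{1,…,n}` attached to `a ∈ {1,…,n−1}`. -/
def lo {n : ℕ} (a : Fin (n - 1)) : Fin n := ⟨a, by omega⟩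
def hi {n : ℕ} (a : Fin (n - 1)) : Fin n := ⟨(a : ℕ) + 1, by omega⟩

lemma lo_ne_hi {n : ℕ} (a : Fin (n - 1)) : (lo a : Fin n) ≠ hi a := by
  simp [lo, hi, Fin.ext_iff]

/-- Generators of the localized superalgebra
`MK_n = k[y][(y_a − y_b)⁻¹, (y_a + y_b)⁻¹] ⊗_{k[y]} MA_n`:
the generators `y_p`, `c_p`, `e(ν)` of `MA_n` together with the inverses
`im p q = (y_q − y_p)⁻¹` and `ip p q = (y_q + y_p)⁻¹` (`p ≠ q`). -/
inductive MKGen (J : Type) (n : ℕ) : Type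
  | y (p : Fin n)
  | cl (p : Fin n)
  | e (ν : Fin n → J)
  | im (p q : Fin n) (h : p ≠ q)
  | ip (p q : Fin n) (h : p ≠ q)

variable (k : Type) [CommRing k] (n : ℕ) (J : Type) [Fintype J] [DecidableEq J]
  (c : J → J)

abbrev MKFree := FreeAlgebra k (MKGen J n)

def yF (p : Fin n) : MKFree k n J := FreeAlgebra.ι k (MKGen.y p)
def clF (p : Fin n) : MKFree k n J := FreeAlgebra.ι k (MKGen.cl p)
def eF (ν : Fin n → J) : MKFree k n J := FreeAlgebra.ι k (MKGen.e ν)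
def imF (p q : Fin n) (h : p ≠ q) : MKFree k n J := FreeAlgebra.ι k (MKGen.im p q h)
def ipF (p q : Fin n) (h : p ≠ q) : MKFree k n J := FreeAlgebra.ι k (MKGen.ip p q h)

/-- The defining relations of `MK_n`: the relations of `MA_n` together with the
relations making `im p q` and `ip p q` two-sided inverses of `y_q − y_p` and
`y_q + y_p` respectively. -/
inductive MKRel : MKFree k n J → MKFree k n J → Prop
  | e_orth (μ ν : Fin n → J) (h : μ ≠ ν) : MKRel (eF k n J μ * eF k n J ν) 0
  | e_idem (ν : Fin n → J) : MKRel (eF k n J ν * eF k n J ν) (eF k n J ν)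
  | e_sum : MKRel (∑ ν : Fin n → J, eF k n J ν) 1
  | ye (p : Fin n) (ν : Fin n → J) : MKRel (yF k n J p * eF k n J ν) (eF k n J ν * yF k n J p)
  | cle (p : Fin n) (ν : Fin n → J) :
      MKRel (clF k n J p * eF k n J ν)
        (eF k n J (Function.update ν p (c (ν p))) * clF k n J p)
  | yy (p q : Fin n) : MKRel (yF k n J p * yF k n J q) (yF k n J q * yF k n J p)
  | clcl (p q : Fin n) :
      MKRel (clF k n J p * clF k n J q + clF k n J q * clF k n J p)
        (if p = q then 2 else 0)
  | cly (p q : Fin n) :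
      MKRel (clF k n J p * yF k n J q)
        (if p = q then -(yF k n J q * clF k n J p) else yF k n J q * clF k n J p)
  | im_left (p q : Fin n) (h : p ≠ q) :
      MKRel ((yF k n J q - yF k n J p) * imF k n J p q h) 1
  | im_right (p q : Fin n) (h : p ≠ q) :
      MKRel (imF k n J p q h * (yF k n J q - yF k n J p)) 1
  | ip_left (p q : Fin n) (h : p ≠ q) :
      MKRel ((yF k n J q + yF k n J p) * ipF k n J p q h) 1
  | ip_right (p q : Fin n) (h : p ≠ q) :
      MKRel (ipF k n J p q h * (yF k n J q + yF k n J p)) 1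

/-- The localized superalgebra `MK_n`. -/
abbrev MK := RingQuot (MKRel k n J c)

noncomputable def yM (p : Fin n) : MK k n J c :=
  RingQuot.mkAlgHom k (MKRel k n J c) (yF k n J p)
noncomputable def clM (p : Fin n) : MK k n J c :=
  RingQuot.mkAlgHom k (MKRel k n J c) (clF k n J p)
noncomputable def eM (ν : Fin n → J) : MK k n J c :=
  RingQuot.mkAlgHom k (MKRel k n J c) (eF k n J ν)
noncomputable def imM (p q : Fin n) (h : p ≠ q) : MK k n J c :=
  RingQuot.mkAlgHom k (MKRel k n J c) (imF k n J p q h)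
noncomputable def ipM (p q : Fin n) (h : p ≠ q) : MK k n J c :=
  RingQuot.mkAlgHom k (MKRel k n J c) (ipF k n J p q h)

/-- `e′_{a,b} = Σ_{ν_a = ν_b} e(ν)`. -/
noncomputable def ePr (p q : Fin n) : MK k n J c :=
  ∑ ν ∈ Finset.univ.filter (fun ν : Fin n → J => ν p = ν q), eM k n J c ν

/-- `e″_{a,b} = Σ_{ν_a = c(ν_b)} e(ν)`. -/
noncomputable def eDPr (p q : Fin n) : MK k n J c :=
  ∑ ν ∈ Finset.univ.filter (fun ν : Fin n → J => ν p = c (ν q)), eM k n J c ν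

/-- `f_{a,b} = (y_b − y_a)⁻¹ e′_{a,b} + (y_b + y_a)⁻¹ c_a c_b e″_{a,b}`. -/
noncomputable def fM (p q : Fin n) (h : p ≠ q) : MK k n J c :=
  imM k n J c p q h * ePr k n J c p q
    + ipM k n J c p q h * (clM k n J c p * clM k n J c q) * eDPr k n J c p q

section Relations

set_option linter.unusedSectionVars false

variable {k n J c}

lemma eM_mul_eM (μ ν : Fin n → J) :
    eM k n J c μ * eM k n J c ν = if μ = ν then eM k n J c μ else 0 := by
  split_ifs with h
  · subst h
    simpa [eM] using RingQuot.mkAlgHom_rel k (MKRel.e_idem (k := k) (c := c) μ)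
  · simpa [eM] using RingQuot.mkAlgHom_rel k (MKRel.e_orth (k := k) (c := c) μ ν h)

lemma yM_mul_eM (p : Fin n) (ν : Fin n → J) :
    yM k n J c p * eM k n J c ν = eM k n J c ν * yM k n J c p := by
  simpa [eM, yM] using RingQuot.mkAlgHom_rel k (MKRel.ye (k := k) (c := c) p ν)

lemma clM_mul_eM (p : Fin n) (ν : Fin n → J) :
    clM k n J c p * eM k n J c ν
      = eM k n J c (Function.update ν p (c (ν p))) * clM k n J c p := by
  simpa [eM, clM] using RingQuot.mkAlgHom_rel k (MKRel.cle (k := k) (c := c) p ν)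

lemma yM_mul_yM (p q : Fin n) :
    yM k n J c p * yM k n J c q = yM k n J c q * yM k n J c p := by
  simpa [yM] using RingQuot.mkAlgHom_rel k (MKRel.yy (k := k) (c := c) p q)

lemma clM_mul_self [Invertible (2 : k)] (p : Fin n) :
    clM k n J c p * clM k n J c p = 1 := by
  have h := RingQuot.mkAlgHom_rel k (MKRel.clcl (k := k) (J := J) (c := c) p p)
  simp only [map_add, map_mul, if_true, map_ofNat] at h
  change clM k n J c p * clM k n J c p + clM k n J c p * clM k n J c p = 2 at h
  have h2 : (2 : k) • (clM k n J c p * clM k n J c p) = (2 : k) • (1 : MK k n J c) := by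
    rw [two_smul, two_smul, h, one_add_one_eq_two]
  simpa [smul_smul] using congrArg (fun x => (⅟2 : k) • x) h2

lemma clM_mul_clM {p q : Fin n} (h : p ≠ q) :
    clM k n J c p * clM k n J c q = -(clM k n J c q * clM k n J c p) := by
  have h' := RingQuot.mkAlgHom_rel k (MKRel.clcl (k := k) (J := J) (c := c) p q)
  simp only [map_add, map_mul, if_neg h, map_zero] at h'
  exact eq_neg_of_add_eq_zero_left h'

lemma clM_mul_yM_self (p : Fin n) :
    clM k n J c p * yM k n J c p = -(yM k n J c p * clM k n J c p) := by
  simpa [yM, clM] using RingQuot.mkAlgHom_rel k (MKRel.cly (k := k) (J := J) (c := c) p p)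

lemma clM_mul_yM {p q : Fin n} (h : p ≠ q) :
    clM k n J c p * yM k n J c q = yM k n J c q * clM k n J c p := by
  simpa [yM, clM, h] using RingQuot.mkAlgHom_rel k (MKRel.cly (k := k) (J := J) (c := c) p q)

lemma sub_mul_imM {p q : Fin n} (h : p ≠ q) :
    (yM k n J c q - yM k n J c p) * imM k n J c p q h = 1 := by
  simpa [yM, imM] using RingQuot.mkAlgHom_rel k (MKRel.im_left (k := k) (J := J) (c := c) p q h)

lemma imM_mul_sub {p q : Fin n} (h : p ≠ q) :
    imM k n J c p q h * (yM k n J c q - yM k n J c p) = 1 := by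
  simpa [yM, imM] using RingQuot.mkAlgHom_rel k (MKRel.im_right (k := k) (J := J) (c := c) p q h)

lemma add_mul_ipM {p q : Fin n} (h : p ≠ q) :
    (yM k n J c q + yM k n J c p) * ipM k n J c p q h = 1 := by
  simpa [yM, ipM] using RingQuot.mkAlgHom_rel k (MKRel.ip_left (k := k) (J := J) (c := c) p q h)

lemma ipM_mul_add {p q : Fin n} (h : p ≠ q) :
    ipM k n J c p q h * (yM k n J c q + yM k n J c p) = 1 := by
  simpa [yM, ipM] using RingQuot.mkAlgHom_rel k (MKRel.ip_right (k := k) (J := J) (c := c) p q h)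

end Relations

/-- An element intertwining `x` and `x'` intertwines their inverses. -/
lemma mul_inv_eq_inv_mul {R : Type*} [Ring R] {u x x' i i' : R}
    (hx : x * i = 1) (hx' : i' * x' = 1) (h : u * x = x' * u) : u * i = i' * u :=
  calc u * i = i' * (x' * u) * i := by rw [← mul_assoc i', hx', one_mul]
    _ = i' * u * (x * i) := by rw [← h]; simp only [mul_assoc]
    _ = i' * u := by rw [hx, mul_one]

/-- The partial fraction identity for `x + y + z = 0`. -/
lemma inv_mul_inv_add_eq_zero {R : Type*} [Ring R] {x y z i j l : R}
    (hx : x * i = 1) (hy : y * j = 1) (hz : z * l = 1)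
    (hij : Commute i j) (hjl : Commute j l) (hli : Commute l i) (h : x + y + z = 0) :
    i * j + j * l + l * i = 0 := by
  have h1 : i * j = z * (i * j * l) := by
    rw [← (hli.mul_right hjl.symm).eq, ← mul_assoc, hz, one_mul]
  have h2 : j * l = x * (i * j * l) := by
    rw [mul_assoc i, ← mul_assoc, hx, one_mul]
  have h3 : l * i = y * (i * j * l) := by
    rw [hij.eq, mul_assoc j, ← mul_assoc, hy, one_mul, hli.eq]
  calc i * j + j * l + l * i = (x + y + z) * (i * j * l) := by
        nth_rewrite 1 [h1, h2, h3]
        noncomm_ring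
    _ = 0 := by rw [h, zero_mul]

/-- Expansion of a product of two elements of the shape of `f_{a,b}`, with the scalars moved to
the left and the idempotents to the right. -/
lemma add_mul_add_of_intertwine {R : Type*} [Ring R] {A A' B B' D D' E E' u v w : R}
    (hEA : E * A' = A' * E) (hEB : E * B' = B' * E)
    (hDA : D * A' = A' * D) (hDB : D * B' = B' * D)
    (hE : E * v = v * D) (hD : D * v = v * E)
    (hcA : u * A' = B' * u) (hcB : u * B' = A' * u) (hcc : u * v = -w) :
    (A * E + B * u * D) * (A' * E' + B' * v * D')
      = A * A' * (E * E') + A * B' * v * (D * D') + B * B' * u * (D * E')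
        - B * A' * w * (E * D') := by
  calc (A * E + B * u * D) * (A' * E' + B' * v * D')
      = A * (E * A') * E' + A * (E * B') * v * D' + B * u * (D * A') * E'
          + B * u * (D * B') * v * D' := by noncomm_ring
    _ = A * A' * (E * E') + A * B' * (E * v) * D' + B * (u * A') * D * E'
          + B * (u * B') * (D * v) * D' := by
        rw [hEA, hEB, hDA, hDB]
        noncomm_ring
    _ = A * A' * (E * E') + A * B' * v * (D * D') + B * B' * u * (D * E')
          + B * A' * (u * v) * (E * D') := by
        rw [hE, hD, hcA, hcB]
        noncomm_ring
    _ = _ := by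
        rw [hcc, mul_neg, neg_mul, sub_eq_add_neg]

section Localization

variable {k n J c}

lemma commute_imM_of_commute_yM {u : MK k n J c} (hu : ∀ p, Commute u (yM k n J c p))
    {p q : Fin n} (h : p ≠ q) : Commute u (imM k n J c p q h) :=
  mul_inv_eq_inv_mul (sub_mul_imM h) (imM_mul_sub h) ((hu q).sub_right (hu p))

lemma commute_ipM_of_commute_yM {u : MK k n J c} (hu : ∀ p, Commute u (yM k n J c p))
    {p q : Fin n} (h : p ≠ q) : Commute u (ipM k n J c p q h) :=
  mul_inv_eq_inv_mul (add_mul_ipM h) (ipM_mul_add h) ((hu q).add_right (hu p))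

lemma commute_imM_yM {p q : Fin n} (h : p ≠ q) (s : Fin n) :
    Commute (imM k n J c p q h) (yM k n J c s) :=
  (commute_imM_of_commute_yM (yM_mul_yM s) h).symm

lemma commute_ipM_yM {p q : Fin n} (h : p ≠ q) (s : Fin n) :
    Commute (ipM k n J c p q h) (yM k n J c s) :=
  (commute_ipM_of_commute_yM (yM_mul_yM s) h).symm

lemma clM_mul_imM_left {p q : Fin n} (h : p ≠ q) :
    clM k n J c p * imM k n J c p q h = ipM k n J c p q h * clM k n J c p := by
  refine mul_inv_eq_inv_mul (sub_mul_imM h) (ipM_mul_add h) ?_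
  rw [mul_sub, add_mul, clM_mul_yM h, clM_mul_yM_self, sub_neg_eq_add]

lemma clM_mul_ipM_left {p q : Fin n} (h : p ≠ q) :
    clM k n J c p * ipM k n J c p q h = imM k n J c p q h * clM k n J c p := by
  refine mul_inv_eq_inv_mul (add_mul_ipM h) (imM_mul_sub h) ?_
  rw [mul_add, sub_mul, clM_mul_yM h, clM_mul_yM_self, sub_eq_add_neg]

lemma clM_mul_imM {p q s : Fin n} (h : p ≠ q) (hp : s ≠ p) (hq : s ≠ q) :
    clM k n J c s * imM k n J c p q h = imM k n J c p q h * clM k n J c s := by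
  refine mul_inv_eq_inv_mul (sub_mul_imM h) (imM_mul_sub h) ?_
  rw [mul_sub, sub_mul, clM_mul_yM hp, clM_mul_yM hq]

lemma clM_mul_ipM {p q s : Fin n} (h : p ≠ q) (hp : s ≠ p) (hq : s ≠ q) :
    clM k n J c s * ipM k n J c p q h = ipM k n J c p q h * clM k n J c s := by
  refine mul_inv_eq_inv_mul (add_mul_ipM h) (ipM_mul_add h) ?_
  rw [mul_add, add_mul, clM_mul_yM hp, clM_mul_yM hq]

end Localization

/-- The idempotent `Σ_{P ν} e(ν)`. -/
noncomputable def eSum (P : (Fin n → J) → Prop) [DecidablePred P] : MK k n J c :=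
  ∑ ν ∈ Finset.univ.filter P, eM k n J c ν

section Idempotents

variable {k n J c}

lemma commute_eSum_yM (P : (Fin n → J) → Prop) [DecidablePred P] (p : Fin n) :
    Commute (eSum k n J c P) (yM k n J c p) :=
  Commute.sum_left _ _ _ fun ν _ => (yM_mul_eM p ν).symm

lemma eSum_mul_eSum (P Q R : (Fin n → J) → Prop) [DecidablePred P] [DecidablePred Q]
    [DecidablePred R] (h : ∀ ν, R ν ↔ P ν ∧ Q ν) :
    eSum k n J c P * eSum k n J c Q = eSum k n J c R := by
  simp only [eSum, Finset.sum_mul_sum, eM_mul_eM, Finset.sum_ite_eq, Finset.mem_filter,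
    Finset.mem_univ, true_and, ← Finset.sum_filter, Finset.filter_filter, h]

lemma clM_mul_eSum (hc : Function.Involutive c) (p : Fin n) (P Q : (Fin n → J) → Prop)
    [DecidablePred P] [DecidablePred Q]
    (h : ∀ ν, Q (Function.update ν p (c (ν p))) ↔ P ν) :
    clM k n J c p * eSum k n J c P = eSum k n J c Q * clM k n J c p := by
  have hinv : Function.Involutive fun ν : Fin n → J => Function.update ν p (c (ν p)) := by
    intro ν
    simp [hc (ν p)]
  simp only [eSum, Finset.mul_sum, Finset.sum_mul, clM_mul_eM]
  refine Finset.sum_equiv hinv.toPerm (fun ν => ?_) (fun ν _ => rfl)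
  simp [h]

lemma clM_mul_ePr_right (hc : Function.Involutive c) {p q : Fin n} (h : p ≠ q) :
    clM k n J c q * ePr k n J c p q = eDPr k n J c p q * clM k n J c q :=
  clM_mul_eSum hc q _ _ fun ν => by simp [h, hc (ν q)]

lemma clM_mul_eDPr_right (hc : Function.Involutive c) {p q : Fin n} (h : p ≠ q) :
    clM k n J c q * eDPr k n J c p q = ePr k n J c p q * clM k n J c q :=
  clM_mul_eSum hc q _ _ fun ν => by simp [h]

lemma clM_mul_ePr (hc : Function.Involutive c) {p q s : Fin n} (hp : p ≠ s) (hq : q ≠ s) :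
    clM k n J c s * ePr k n J c p q = ePr k n J c p q * clM k n J c s :=
  clM_mul_eSum hc s _ _ fun ν => by simp [hp, hq]

lemma clM_mul_eDPr (hc : Function.Involutive c) {p q s : Fin n} (hp : p ≠ s) (hq : q ≠ s) :
    clM k n J c s * eDPr k n J c p q = eDPr k n J c p q * clM k n J c s :=
  clM_mul_eSum hc s _ _ fun ν => by simp [hp, hq]

lemma ePr_mul_ePr (p q r : Fin n) :
    ePr k n J c p q * ePr k n J c q r = eSum k n J c fun ν => ν p = ν q ∧ ν q = ν r :=
  eSum_mul_eSum _ _ _ fun _ => Iff.rfl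

lemma eDPr_mul_eDPr (hc : Function.Involutive c) (p q r : Fin n) :
    eDPr k n J c p q * eDPr k n J c q r = eSum k n J c fun ν => ν p = ν r ∧ ν r = c (ν q) :=
  eSum_mul_eSum _ _ _ fun ν => by
    have h1 := hc (ν q)
    have h2 := hc (ν r)
    grind

lemma eDPr_mul_ePr (hc : Function.Involutive c) (p q r : Fin n) :
    eDPr k n J c p q * ePr k n J c q r = eSum k n J c fun ν => ν r = ν q ∧ ν q = c (ν p) :=
  eSum_mul_eSum _ _ _ fun ν => by
    have h1 := hc (ν q)
    have h2 := hc (ν p)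
    grind

lemma ePr_mul_eDPr (p q r : Fin n) :
    ePr k n J c p q * eDPr k n J c q r = eSum k n J c fun ν => ν q = ν p ∧ ν p = c (ν r) :=
  eSum_mul_eSum _ _ _ fun ν => by grind

end Idempotents

section Product

variable {k n J c}

lemma fM_mul_fM [Invertible (2 : k)] (hc : Function.Involutive c)
    {p q r : Fin n} (hpq : p ≠ q) (hqr : q ≠ r) (hrp : r ≠ p) :
    fM k n J c p q hpq * fM k n J c q r hqr =
      imM k n J c p q hpq * imM k n J c q r hqr
          * eSum k n J c (fun ν => ν p = ν q ∧ ν q = ν r)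
        + imM k n J c p q hpq * ipM k n J c q r hqr * (clM k n J c q * clM k n J c r)
          * eSum k n J c (fun ν => ν p = ν r ∧ ν r = c (ν q))
        + ipM k n J c p q hpq * ipM k n J c q r hqr * (clM k n J c p * clM k n J c q)
          * eSum k n J c (fun ν => ν r = ν q ∧ ν q = c (ν p))
        - ipM k n J c p q hpq * imM k n J c q r hqr * (clM k n J c r * clM k n J c p)
          * eSum k n J c (fun ν => ν q = ν p ∧ ν p = c (ν r)) := by
  rw [← ePr_mul_ePr, ← eDPr_mul_eDPr hc, ← eDPr_mul_ePr hc, ← ePr_mul_eDPr, fM, fM]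
  have hEA : ePr k n J c p q * imM k n J c q r hqr = imM k n J c q r hqr * ePr k n J c p q :=
    commute_imM_of_commute_yM (commute_eSum_yM _) hqr
  have hEB : ePr k n J c p q * ipM k n J c q r hqr = ipM k n J c q r hqr * ePr k n J c p q :=
    commute_ipM_of_commute_yM (commute_eSum_yM _) hqr
  have hDA : eDPr k n J c p q * imM k n J c q r hqr = imM k n J c q r hqr * eDPr k n J c p q :=
    commute_imM_of_commute_yM (commute_eSum_yM _) hqr
  have hDB : eDPr k n J c p q * ipM k n J c q r hqr = ipM k n J c q r hqr * eDPr k n J c p q :=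
    commute_ipM_of_commute_yM (commute_eSum_yM _) hqr
  have hE : ePr k n J c p q * (clM k n J c q * clM k n J c r)
      = clM k n J c q * clM k n J c r * eDPr k n J c p q := by
    rw [← mul_assoc, ← clM_mul_eDPr_right hc hpq, mul_assoc, mul_assoc,
      clM_mul_eDPr hc hrp.symm hqr]
  have hD : eDPr k n J c p q * (clM k n J c q * clM k n J c r)
      = clM k n J c q * clM k n J c r * ePr k n J c p q := by
    rw [← mul_assoc, ← clM_mul_ePr_right hc hpq, mul_assoc, mul_assoc,
      clM_mul_ePr hc hrp.symm hqr]
  have hcA : clM k n J c p * clM k n J c q * imM k n J c q r hqr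
      = ipM k n J c q r hqr * (clM k n J c p * clM k n J c q) := by
    rw [mul_assoc, clM_mul_imM_left, ← mul_assoc, clM_mul_ipM hqr hpq hrp.symm, mul_assoc]
  have hcB : clM k n J c p * clM k n J c q * ipM k n J c q r hqr
      = imM k n J c q r hqr * (clM k n J c p * clM k n J c q) := by
    rw [mul_assoc, clM_mul_ipM_left, ← mul_assoc, clM_mul_imM hqr hpq hrp.symm, mul_assoc]
  have hcc : clM k n J c p * clM k n J c q * (clM k n J c q * clM k n J c r)
      = -(clM k n J c r * clM k n J c p) := by
    rw [mul_assoc, ← mul_assoc (clM k n J c q), clM_mul_self, one_mul, clM_mul_clM hrp.symm]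
  exact add_mul_add_of_intertwine hEA hEB hDA hDB hE hD hcA hcB hcc

lemma imM_mul_imM_add {p q r : Fin n} (hpq : p ≠ q) (hqr : q ≠ r) (hrp : r ≠ p) :
    imM k n J c p q hpq * imM k n J c q r hqr + imM k n J c q r hqr * imM k n J c r p hrp
      + imM k n J c r p hrp * imM k n J c p q hpq = 0 :=
  inv_mul_inv_add_eq_zero (sub_mul_imM hpq) (sub_mul_imM hqr) (sub_mul_imM hrp)
    (commute_imM_of_commute_yM (commute_imM_yM hpq) hqr)
    (commute_imM_of_commute_yM (commute_imM_yM hqr) hrp)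
    (commute_imM_of_commute_yM (commute_imM_yM hrp) hpq) (by abel)

lemma imM_mul_ipM_add {p q r : Fin n} (hpq : p ≠ q) (hqr : q ≠ r) (hrp : r ≠ p) :
    imM k n J c p q hpq * ipM k n J c q r hqr + ipM k n J c q r hqr * ipM k n J c r p hrp
      - ipM k n J c r p hrp * imM k n J c p q hpq = 0 := by
  have h := inv_mul_inv_add_eq_zero (sub_mul_imM (k := k) (J := J) (c := c) hpq)
    ((neg_mul_neg _ _).trans (add_mul_ipM hqr)) (add_mul_ipM hrp)
    (commute_ipM_of_commute_yM (commute_imM_yM hpq) hqr).neg_right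
    (commute_ipM_of_commute_yM (commute_ipM_yM hqr) hrp).neg_left
    (commute_imM_of_commute_yM (commute_ipM_yM hrp) hpq) (by abel)
  rw [← neg_eq_zero, ← h]
  noncomm_ring

end Product

theorem f_cocycle [Invertible (2 : k)] (hc : Function.Involutive c)
    (p q r : Fin n) (hpq : p ≠ q) (hqr : q ≠ r) (hrp : r ≠ p) :
    fM k n J c p q hpq * fM k n J c q r hqr
      + fM k n J c q r hqr * fM k n J c r p hrp
      + fM k n J c r p hrp * fM k n J c p q hpq = 0 := by
  rw [fM_mul_fM hc hpq hqr hrp, fM_mul_fM hc hqr hrp hpq, fM_mul_fM hc hrp hpq hqr]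
  have h1 : eSum k n J c (fun ν => ν q = ν r ∧ ν r = ν p)
      = eSum k n J c (fun ν => ν p = ν q ∧ ν q = ν r) := by
    unfold eSum
    congr 2
    grind
  have h2 : eSum k n J c (fun ν => ν r = ν p ∧ ν p = ν q)
      = eSum k n J c (fun ν => ν p = ν q ∧ ν q = ν r) := by
    unfold eSum
    congr 2
    grind
  rw [h1, h2]
  have hA := congrArg (· * eSum k n J c (fun ν => ν p = ν q ∧ ν q = ν r))
    (imM_mul_imM_add (k := k) (J := J) (c := c) hpq hqr hrp)
  have hp := congrArg (· * (clM k n J c q * clM k n J c r)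
    * eSum k n J c (fun ν => ν p = ν r ∧ ν r = c (ν q))) (imM_mul_ipM_add hpq hqr hrp)
  have hq := congrArg (· * (clM k n J c r * clM k n J c p)
    * eSum k n J c (fun ν => ν q = ν p ∧ ν p = c (ν r))) (imM_mul_ipM_add hqr hrp hpq)
  have hr := congrArg (· * (clM k n J c p * clM k n J c q)
    * eSum k n J c (fun ν => ν r = ν q ∧ ν q = c (ν p))) (imM_mul_ipM_add hrp hpq hqr)
  simp only [add_mul, sub_mul, zero_mul] at hA hp hq hr
  linear_combination (norm := abel) hA + hp + hq + hr

end QuiverHeckeSuper4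
end
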